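/- The space (Q^{U_n})^{sgn} of U_n-invariant polynomials f in Q satisfying τ·f = sgn(τ)·f for all τ ∈ S₃ is spanned as a ℂ-vector space by the set {α₁^a α₂^b α₃^c γ₁^{2d+1} γ₂^{2e} : a, b, c, d, e ∈ ℤ_{≥0}} ∪ {α₁^a α₂^b α₃^c γ₁^{2d} γ₂^{2e+1} : a, b, c, d, e ∈ ℤ_{≥0}}. -/

import Mathlib

open MvPolynomial

noncomputable section

/-- The polynomial ring `𝒫 = ℂ[x_{ij} : 1 ≤ i ≤ n, 1 ≤ j ≤ 3]` in the entries of an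
`n × 3` matrix of indeterminates. -/
abbrev P (n : ℕ) : Type := MvPolynomial (Fin n × Fin 3) ℂ

/-- The action of a matrix `g` on `𝒫`, given by `(g · f)(X) = f(gᵀ X)`;
on variables it sends `x_{ij} ↦ ∑ s g_{si} x_{sj}`. -/
def matAct (n : ℕ) (g : Matrix (Fin n) (Fin n) ℂ) : P n →ₐ[ℂ] P n :=
  aeval fun p : Fin n × Fin 3 => ∑ s : Fin n, C (g s p.1) * X (s, p.2)

/-- The action of `σ ∈ S₃` permuting columns: `x_{ij} ↦ x_{iσ(j)}`. -/
def permAct (n : ℕ) (σ : Equiv.Perm (Fin 3)) : P n →ₐ[ℂ] P n :=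
  aeval fun p : Fin n × Fin 3 => X (p.1, σ p.2)

/-- `g` is upper triangular with all diagonal entries equal to `1`, i.e. `g ∈ U_n`. -/
def IsUpperUni (n : ℕ) (g : Matrix (Fin n) (Fin n) ℂ) : Prop :=
  (∀ i, g i i = 1) ∧ ∀ i j, j < i → g i j = 0

/-- `f` is `U_n`-invariant. -/
def UInv (n : ℕ) (f : P n) : Prop :=
  ∀ g : Matrix (Fin n) (Fin n) ℂ, IsUpperUni n g → matAct n g f = f

/-- `f ∈ Q_m` : each monomial of `f` has total degree `m` in the column-`j` variables,
for each `j`. -/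
def InQm (n m : ℕ) (f : P n) : Prop :=
  ∀ d ∈ f.support, ∀ j : Fin 3, (∑ i : Fin n, d (i, j)) = m

/-- `f ∈ Q = ⊕ₘ Q_m` : each monomial of `f` has equal total degree in the three columns. -/
def InQ (n : ℕ) (f : P n) : Prop :=
  ∀ d ∈ f.support, ∀ j : Fin 3, (∑ i : Fin n, d (i, j)) = ∑ i : Fin n, d (i, (0 : Fin 3))

/-- The variable `x_{(i+1)(j+1)}`, `i j : Fin 3` (0-indexed rows and columns). -/
def Xe (n : ℕ) (hn : 3 ≤ n) (i j : Fin 3) : P n := X (Fin.castLE hn i, j)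

/-- `δ_{ij} = x_{1i} x_{2j} - x_{2i} x_{1j}` (0-indexed columns `i j : Fin 3`). -/
def del (n : ℕ) (hn : 3 ≤ n) (i j : Fin 3) : P n :=
  Xe n hn 0 i * Xe n hn 1 j - Xe n hn 1 i * Xe n hn 0 j

/-- `α₁ = x₁₁ x₁₂ x₁₃`. -/
def alpha1 (n : ℕ) (hn : 3 ≤ n) : P n := Xe n hn 0 0 * Xe n hn 0 1 * Xe n hn 0 2

/-- `β₂ = x₁₂ δ₁₃`. -/
def beta2 (n : ℕ) (hn : 3 ≤ n) : P n := Xe n hn 0 1 * del n hn 0 2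

/-- `β₃ = x₁₃ δ₁₂`. -/
def beta3 (n : ℕ) (hn : 3 ≤ n) : P n := Xe n hn 0 2 * del n hn 0 1

/-- `γ₁ = det (x_{ij})_{1 ≤ i,j ≤ 3}`. -/
def gamma1 (n : ℕ) (hn : 3 ≤ n) : P n := Matrix.det (Matrix.of fun i j : Fin 3 => Xe n hn i j)

/-- `γ₂ = δ₁₂ δ₁₃ δ₂₃`. -/
def gamma2 (n : ℕ) (hn : 3 ≤ n) : P n := del n hn 0 1 * del n hn 0 2 * del n hn 1 2

/-- `α₂ = β₂² + β₃² − β₂ β₃`. -/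
def alpha2 (n : ℕ) (hn : 3 ≤ n) : P n := beta2 n hn ^ 2 + beta3 n hn ^ 2 - beta2 n hn * beta3 n hn

/-- `α₃ = 2(β₂³ + β₃³) − 3(β₂² β₃ + β₂ β₃²)`. -/
def alpha3 (n : ℕ) (hn : 3 ≤ n) : P n :=
  2 * (beta2 n hn ^ 3 + beta3 n hn ^ 3) -
    3 * (beta2 n hn ^ 2 * beta3 n hn + beta2 n hn * beta3 n hn ^ 2)

/-- The spanning family for `(Q^{U_n})^{sgn}`: the left summand indexes
`α₁^a α₂^b α₃^c γ₁^{2d+1} γ₂^{2e}`, the right summand indexes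
`α₁^a α₂^b α₃^c γ₁^{2d} γ₂^{2e+1}`, with `a b c d e : ℕ`. -/
def Ssgn (n : ℕ) (hn : 3 ≤ n) :
    (ℕ × ℕ × ℕ × ℕ × ℕ) ⊕ (ℕ × ℕ × ℕ × ℕ × ℕ) → P n
  | Sum.inl (a, b, c, d, e) =>
      alpha1 n hn ^ a * alpha2 n hn ^ b * alpha3 n hn ^ c *
        gamma1 n hn ^ (2 * d + 1) * gamma2 n hn ^ (2 * e)
  | Sum.inr (a, b, c, d, e) =>
      alpha1 n hn ^ a * alpha2 n hn ^ b * alpha3 n hn ^ c *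
        gamma1 n hn ^ (2 * d) * gamma2 n hn ^ (2 * e + 1)

/-! ### Divisibility of polynomials by `X i - p` -/

lemma X_sub_dvd_sub_aeval_update {σ : Type*} [DecidableEq σ] (i : σ) (p F : MvPolynomial σ ℂ) :
    X i - p ∣ F - aeval (Function.update X i p) F := by
  induction F using MvPolynomial.induction_on with
  | C a => simp
  | add F G hF hG =>
    rw [map_add, add_sub_add_comm]
    exact dvd_add hF hG
  | mul_X F j hF =>
    have hj : X i - p ∣ X j - Function.update X i p j := by
      rcases eq_or_ne j i with rfl | h
      · simp
      · simp [Function.update_of_ne h]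
    rw [map_mul, aeval_X]
    obtain ⟨A, hA⟩ := hF
    obtain ⟨B, hB⟩ := hj
    refine ⟨A * X j + aeval (Function.update X i p) F * B, ?_⟩
    linear_combination X j * hA + aeval (Function.update X i p) F * hB

lemma eval_aeval {σ τ : Type*} (f : σ → MvPolynomial τ ℂ) (F : MvPolynomial σ ℂ) (z : τ → ℂ) :
    eval z (aeval f F) = eval (fun i => eval z (f i)) F := by
  induction F using MvPolynomial.induction_on with
  | C a => simp
  | add F G hF hG => rw [map_add, map_add, map_add, hF, hG]
  | mul_X F j hF => rw [map_mul, map_mul, map_mul, hF, aeval_X, eval_X]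

lemma eval_aeval_update {σ : Type*} [DecidableEq σ] (i : σ) (p F : MvPolynomial σ ℂ) (z : σ → ℂ) :
    eval z (aeval (Function.update X i p) F) = eval (Function.update z i (eval z p)) F := by
  rw [eval_aeval]
  congr 2
  funext j
  rcases eq_or_ne j i with rfl | h
  · simp
  · simp [Function.update_of_ne h]

/-- If `F` vanishes on the hypersurface `X i = p`, away from the zeros of `q`, then `X i - p`
divides `F`. -/
lemma X_sub_dvd_of_eval_eq_zero {σ : Type*} [DecidableEq σ] {i : σ} {p q F : MvPolynomial σ ℂ}
    (hq : q ≠ 0)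
    (h : ∀ z : σ → ℂ, eval z q ≠ 0 → eval (Function.update z i (eval z p)) F = 0) :
    X i - p ∣ F := by
  have h0 : aeval (Function.update X i p) F = 0 := by
    refine (mul_eq_zero.mp (MvPolynomial.funext fun z => ?_)).resolve_left hq
    rw [map_mul, eval_aeval_update, map_zero]
    by_cases hz : eval z q = 0
    · rw [hz, zero_mul]
    · rw [h z hz, mul_zero]
  simpa only [h0, sub_zero] using X_sub_dvd_sub_aeval_update i p F

/-! ### Evaluation at matrices -/

section Points

variable {n : ℕ} (hn : 3 ≤ n)

/-- The `n × 3` matrix whose first three rows are `T`, and whose other rows vanish. -/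
def extendRows (n : ℕ) (T : Matrix (Fin 3) (Fin 3) ℂ) (p : Fin n × Fin 3) : ℂ :=
  if h : p.1.val < 3 then T ⟨p.1.val, h⟩ p.2 else 0

/-- The `3 × 3` block formed by the first three rows of an `n × 3` matrix. -/
def topRows (x : Fin n × Fin 3 → ℂ) : Matrix (Fin 3) (Fin 3) ℂ :=
  fun i j => x (Fin.castLE hn i, j)

lemma topRows_extendRows (T : Matrix (Fin 3) (Fin 3) ℂ) : topRows hn (extendRows n T) = T := by
  ext i j
  simp [topRows, extendRows]

lemma eval_Xe (x : Fin n × Fin 3 → ℂ) (i j : Fin 3) :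
    eval x (Xe n hn i j) = topRows hn x i j := by
  simp [Xe, topRows]

/-- The values of `α₁, β₂, β₃, γ₁, γ₂` at a matrix with first three rows `T`. -/
def genValues (T : Matrix (Fin 3) (Fin 3) ℂ) : Fin 5 → ℂ :=
  ![T 0 0 * T 0 1 * T 0 2,
    T 0 1 * (T 0 0 * T 1 2 - T 1 0 * T 0 2),
    T 0 2 * (T 0 0 * T 1 1 - T 1 0 * T 0 1),
    T.det,
    (T 0 0 * T 1 1 - T 1 0 * T 0 1) * (T 0 0 * T 1 2 - T 1 0 * T 0 2) *
      (T 0 1 * T 1 2 - T 1 1 * T 0 2)]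

/-- The substitution `(a, u, v, g, w) ↦ (α₁, β₂, β₃, γ₁, γ₂)`. -/
def genHom : MvPolynomial (Fin 5) ℂ →ₐ[ℂ] P n :=
  aeval ![alpha1 n hn, beta2 n hn, beta3 n hn, gamma1 n hn, gamma2 n hn]

/-- The substitution `(a, u, v, g) ↦ (α₁, β₂, β₃, γ₁)`. -/
def genHom₄ : MvPolynomial (Fin 4) ℂ →ₐ[ℂ] P n :=
  aeval ![alpha1 n hn, beta2 n hn, beta3 n hn, gamma1 n hn]

lemma eval_gens (x : Fin n × Fin 3 → ℂ) (k : Fin 5) :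
    eval x (![alpha1 n hn, beta2 n hn, beta3 n hn, gamma1 n hn, gamma2 n hn] k) =
      genValues (topRows hn x) k := by
  fin_cases k <;>
    simp [genValues, alpha1, beta2, beta3, gamma1, gamma2, del, eval_Xe, Matrix.det_fin_three]

lemma eval_genHom (x : Fin n × Fin 3 → ℂ) (F : MvPolynomial (Fin 5) ℂ) :
    eval x (genHom hn F) = eval (genValues (topRows hn x)) F := by
  rw [genHom, eval_aeval]
  exact congrArg (fun z => eval z F) (funext (eval_gens hn x))

lemma eval_genHom₄ (x : Fin n × Fin 3 → ℂ) (F : MvPolynomial (Fin 4) ℂ) :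
    eval x (genHom₄ hn F) = eval (fun k => genValues (topRows hn x) k.castSucc) F := by
  rw [genHom₄, eval_aeval]
  congr 2
  funext k
  rw [← eval_gens]
  fin_cases k <;> rfl

lemma beta_relation : beta2 n hn * beta3 n hn * (beta2 n hn - beta3 n hn) =
    alpha1 n hn * gamma2 n hn := by
  simp only [alpha1, beta2, beta3, gamma2, del]
  ring

lemma gens_ne_zero : alpha1 n hn ≠ 0 ∧ beta3 n hn ≠ 0 ∧ gamma1 n hn ≠ 0 := by
  have key (k : Fin 5) (T : Matrix (Fin 3) (Fin 3) ℂ) (hT : genValues T k ≠ 0) :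
      ![alpha1 n hn, beta2 n hn, beta3 n hn, gamma1 n hn, gamma2 n hn] k ≠ 0 := fun h => by
    have := eval_gens hn (extendRows n T) k
    rw [h, topRows_extendRows, map_zero] at this
    exact hT this.symm
  refine ⟨key 0 !![1, 1, 1; 0, 1, 1; 0, 0, 1] ?_, key 2 !![1, 1, 1; 0, 1, 1; 0, 0, 1] ?_,
    key 3 !![1, 1, 1; 0, 1, 1; 0, 0, 1] ?_⟩ <;> simp [genValues, Matrix.det_fin_three]

/-- If `β₃ h` is a polynomial in `α₁, β₂, β₃, γ₁`, then so is `h`. -/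
lemma exists_genHom₄_of_beta3_mul {h : P n} {F : MvPolynomial (Fin 4) ℂ}
    (hF : beta3 n hn * h = genHom₄ hn F) : ∃ F', h = genHom₄ hn F' := by
  have hdvd : X 2 - 0 ∣ F := by
    refine X_sub_dvd_of_eval_eq_zero (X_ne_zero (1 : Fin 4)) fun z hz => ?_
    rw [eval_X] at hz
    have e := congrArg (eval (extendRows n !![1, 1, z 0; 0, 0, z 1; z 3 / z 1, 0, 0])) hF
    rw [eval_genHom₄, topRows_extendRows, map_mul,
      show beta3 n hn = ![alpha1 n hn, beta2 n hn, beta3 n hn, gamma1 n hn, gamma2 n hn] 2 from rfl,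
      eval_gens, topRows_extendRows] at e
    convert e.symm using 1
    · congr 2
      funext k
      fin_cases k <;> simp [genValues, Matrix.det_fin_three, Function.update]
      field_simp
    · simp [genValues]
  obtain ⟨F', rfl⟩ := hdvd
  refine ⟨F', mul_left_cancel₀ (gens_ne_zero hn).2.1 (hF.trans ?_)⟩
  simp [genHom₄]

/-- If `α₁ h` is a polynomial in `α₁, β₂, β₃, γ₁, γ₂`, then so is `h`. -/
lemma exists_genHom_of_alpha1_mul {h : P n} {F : MvPolynomial (Fin 5) ℂ}
    (hF : alpha1 n hn * h = genHom hn F) : ∃ F', h = genHom hn F' := by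
  have vanish (T : Matrix (Fin 3) (Fin 3) ℂ) (hT : T 0 0 * T 0 1 * T 0 2 = 0) :
      eval (genValues T) F = 0 := by
    have e := congrArg (eval (extendRows n T)) hF
    rw [eval_genHom, topRows_extendRows, map_mul,
      show alpha1 n hn = ![alpha1 n hn, beta2 n hn, beta3 n hn, gamma1 n hn, gamma2 n hn] 0 from rfl,
      eval_gens, topRows_extendRows] at e
    rw [← e]
    simp [genValues, hT]
  have hv (u v g w : ℂ) (huv : (u = 0 ∧ v ≠ 0) ∨ (u ≠ 0 ∧ v = 0) ∨ (u ≠ 0 ∧ v = u)) :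
      eval ![0, u, v, g, w] F = 0 := by
    rcases huv with ⟨rfl, hv⟩ | ⟨hu, rfl⟩ | ⟨hu, rfl⟩
    · convert vanish !![1, 0, 1; 0, v, -w / v ^ 2; 0, 0, g / v] (by simp) using 3
      simp only [genValues, Matrix.det_fin_three]
      congr! <;> simp <;> field_simp
    · convert vanish !![1, 1, 0; 0, w / u ^ 2, u; g / u, 0, 0] (by simp) using 3
      simp only [genValues, Matrix.det_fin_three]
      congr! <;> simp <;> field_simp
    · convert vanish !![0, 1, 1; -v, 0, w / v ^ 2; 0, -g / v, 0] (by simp) using 3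
      simp only [genValues, Matrix.det_fin_three]
      congr! <;> simp <;> field_simp
  obtain ⟨A, hA⟩ := X_sub_dvd_sub_aeval_update (0 : Fin 5) 0 F
  set F₀ : MvPolynomial (Fin 5) ℂ := aeval (Function.update X 0 0) F with hF₀
  have hF₀_eval (z : Fin 5 → ℂ) : eval z F₀ = eval ![0, z 1, z 2, z 3, z 4] F := by
    rw [hF₀, eval_aeval_update]
    congr 2
    funext k
    fin_cases k <;> simp [Function.update]
  obtain ⟨F₁, hF₁⟩ : X 1 - 0 ∣ F₀ := by
    refine X_sub_dvd_of_eval_eq_zero (X_ne_zero (2 : Fin 5)) fun z hz => ?_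
    rw [eval_X] at hz
    rw [hF₀_eval]
    exact hv _ _ _ _ (Or.inl (by simpa [Function.update] using hz))
  obtain ⟨F₂, hF₂⟩ : X 2 - 0 ∣ F₁ := by
    refine X_sub_dvd_of_eval_eq_zero (X_ne_zero (1 : Fin 5)) fun z hz => ?_
    rw [eval_X] at hz
    have e := hF₀_eval (Function.update z 2 (eval z 0))
    rw [hv _ _ _ _ (Or.inr (Or.inl (by simpa [Function.update] using hz))), hF₁] at e
    simpa [Function.update, hz] using e
  obtain ⟨F₃, hF₃⟩ : X 2 - X 1 ∣ F₂ := by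
    refine X_sub_dvd_of_eval_eq_zero (X_ne_zero (1 : Fin 5)) fun z hz => ?_
    rw [eval_X] at hz
    have e := hF₀_eval (Function.update z 2 (eval z (X 1)))
    rw [hv _ _ _ _ (Or.inr (Or.inr (by simpa [Function.update] using hz))), hF₁, hF₂] at e
    simpa [Function.update, hz] using e
  refine ⟨A - X 4 * F₃, mul_left_cancel₀ (gens_ne_zero hn).1 (hF.trans ?_)⟩
  have hsum : F = X 0 * A + X 1 * (X 2 * ((X 2 - X 1) * F₃)) := by
    rw [← hF₃, ← sub_zero (X 2), ← hF₂, ← sub_zero (X 1), ← hF₁]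
    linear_combination hA
  rw [hsum]
  simp only [genHom, map_add, map_mul, map_sub, aeval_X]
  simp only [Matrix.cons_val]
  linear_combination (-aeval ![alpha1 n hn, beta2 n hn, beta3 n hn, gamma1 n hn, gamma2 n hn] F₃) *
    beta_relation hn

end Points

/-! ### Invariants are polynomials in `α₁, β₂, β₃, γ₁, γ₂` -/

section Invariants

variable {n : ℕ} (hn : 3 ≤ n)

lemma UInv.eval_add_rows {f : P n} (hf : UInv n f) (x : Fin n × Fin 3 → ℂ) (c : Fin n → Fin 3 → ℂ)
    (hc : ∀ i k, i ≤ Fin.castLE hn k → c i k = 0) :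
    eval (fun p => x p + ∑ k, c p.1 k * x (Fin.castLE hn k, p.2)) f = eval x f := by
  let g : Matrix (Fin n) (Fin n) ℂ := fun s i =>
    (if s = i then 1 else 0) + ∑ k, if s = Fin.castLE hn k then c i k else 0
  have hg : IsUpperUni n g := by
    refine ⟨fun i => ?_, fun i j hij => ?_⟩
    · have : ∑ k, (if i = Fin.castLE hn k then c i k else 0) = 0 :=
        Finset.sum_eq_zero fun k _ => ite_eq_right_iff.mpr fun h => hc i k h.le
      simp [g, this]
    · have : ∑ k, (if i = Fin.castLE hn k then c j k else 0) = 0 :=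
        Finset.sum_eq_zero fun k _ => ite_eq_right_iff.mpr fun h => hc j k (h ▸ hij.le)
      simp [g, this, hij.ne']
  conv_rhs => rw [← hf g hg, matAct, eval_aeval]
  congr 2
  funext p
  simp only [g, map_sum, map_mul, eval_C, eval_X, add_mul, Finset.sum_add_distrib, ite_mul, one_mul,
    zero_mul, Finset.sum_ite_eq', Finset.mem_univ, if_true, Finset.sum_mul]
  rw [Finset.sum_comm]
  simp

lemma InQ.eval_scale_columns {f : P n} (hf : InQ n f) (x : Fin n × Fin 3 → ℂ) {t : Fin 3 → ℂ}
    (ht : ∏ j, t j = 1) : eval (fun p => t p.2 * x p) f = eval x f := by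
  rw [eval_eq', eval_eq']
  refine Finset.sum_congr rfl fun d hd => ?_
  have : ∏ p : Fin n × Fin 3, t p.2 ^ d p = 1 := by
    rw [Fintype.prod_prod_type_right]
    simp only [Finset.prod_pow_eq_pow_sum, hf d hd]
    rw [Finset.prod_pow, ht, one_pow]
  simp only [mul_pow, Finset.prod_mul_distrib, this, one_mul]

/-- A matrix at which `α₁, β₂, β₃, γ₁` take the values `z 0, z 1, z 2, z 3`. -/
def normalForm (n : ℕ) (z : Fin 4 → ℂ) : Fin n × Fin 3 → ℂ :=
  extendRows n !![z 0, 1, 1; 0, z 2 / z 0, z 1 / z 0; 0, 0, z 3 / z 2]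

lemma exists_clear_denominators (f : P n) : ∃ (N : ℕ) (F : MvPolynomial (Fin 4) ℂ),
    ∀ z, z 0 ≠ 0 → z 2 ≠ 0 → eval z F = (z 0 * z 2) ^ N * eval (normalForm n z) f := by
  induction f using MvPolynomial.induction_on with
  | C a => exact ⟨0, C a, by simp⟩
  | add f g hf hg =>
    obtain ⟨N, F, hF⟩ := hf
    obtain ⟨M, G, hG⟩ := hg
    refine ⟨N + M, (X 0 * X 2) ^ M * F + (X 0 * X 2) ^ N * G, fun z h0 h2 => ?_⟩
    simp only [map_add, map_mul, map_pow, eval_X, hF z h0 h2, hG z h0 h2]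
    ring
  | mul_X f p hf =>
    obtain ⟨N, F, hF⟩ := hf
    obtain ⟨E, hE⟩ : ∃ E : MvPolynomial (Fin 4) ℂ,
        ∀ z, z 0 ≠ 0 → z 2 ≠ 0 → eval z E = z 0 * z 2 * normalForm n z p := by
      obtain ⟨i, j⟩ := p
      by_cases hi : i.val < 3
      · refine ⟨!![X 0 * X 0 * X 2, X 0 * X 2, X 0 * X 2; 0, X 2 * X 2, X 1 * X 2;
          0, 0, X 0 * X 3] ⟨i, hi⟩ j, fun z h0 h2 => ?_⟩
        simp only [normalForm, extendRows, dif_pos hi]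
        generalize (⟨i, hi⟩ : Fin 3) = k
        fin_cases k <;> fin_cases j <;> simp <;> field_simp
      · exact ⟨0, by simp [normalForm, extendRows, hi]⟩
    refine ⟨N + 1, F * E, fun z h0 h2 => ?_⟩
    simp only [map_mul, eval_X, hF z h0 h2, hE z h0 h2]
    ring

lemma eval_eq_eval_normalForm {f : P n} (hQ : InQ n f) (hU : UInv n f) (x : Fin n × Fin 3 → ℂ)
    (h1 : eval x (alpha1 n hn) ≠ 0) (h2 : eval x (beta3 n hn) ≠ 0)
    (h3 : eval x (gamma1 n hn) ≠ 0) :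
    eval x f = eval (normalForm n fun k => genValues (topRows hn x) k.castSucc) f := by
  set T := topRows hn x
  replace h1 : T 0 0 * T 0 1 * T 0 2 ≠ 0 := fun h => h1 ((eval_gens hn x 0).trans h)
  replace h2 : T 0 2 * (T 0 0 * T 1 1 - T 1 0 * T 0 1) ≠ 0 := fun h => h2 ((eval_gens hn x 2).trans h)
  replace h3 : T.det ≠ 0 := fun h => h3 ((eval_gens hn x 3).trans h)
  obtain ⟨⟨h00, h01⟩, h02⟩ : (T 0 0 ≠ 0 ∧ T 0 1 ≠ 0) ∧ T 0 2 ≠ 0 := by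
    simpa only [mul_ne_zero_iff] using h1
  have hδ : T 0 0 * T 1 1 - T 1 0 * T 0 1 ≠ 0 := right_ne_zero_of_mul h2
  set δ := T 0 0 * T 1 1 - T 1 0 * T 0 1 with hδ_def
  let c : Fin n → Fin 3 → ℂ := fun i =>
    if i.val = 0 then 0 else if i.val = 1 then ![-T 1 0 / T 0 0, 0, 0]
    else if i.val = 2 then
      ![(T 1 0 * T 2 1 - T 1 1 * T 2 0) / δ, -(T 0 0 * T 2 1 - T 0 1 * T 2 0) / δ, 0]
    else -Matrix.vecMul (fun j => x (i, j)) T⁻¹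
  have hc : ∀ i k, i ≤ Fin.castLE hn k → c i k = 0 := by
    intro i k hik
    have hik : i.val ≤ k.val := hik
    have : i.val = 0 ∨ (i.val = 1 ∧ k ≠ 0) ∨ (i.val = 2 ∧ k = 2) := by
      have := k.isLt
      simp only [Fin.ext_iff, ne_eq, Fin.val_zero, Fin.val_two]
      omega
    rcases this with h | ⟨h, hk⟩ | ⟨h, rfl⟩
    · simp [c, h]
    · fin_cases k <;> simp_all [c]
    · simp [c, h]
  rw [← hU.eval_add_rows hn x c hc, ← hQ.eval_scale_columns _
    (t := ![T 0 1 * T 0 2, (T 0 1)⁻¹, (T 0 2)⁻¹]) (by simp [Fin.prod_univ_three]; field_simp)]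
  congr 2
  funext ⟨i, j⟩
  by_cases hi : i.val < 3
  · obtain ⟨k, rfl⟩ : ∃ k : Fin 3, i = Fin.castLE hn k := ⟨⟨i, hi⟩, rfl⟩
    have hx (k j : Fin 3) : x (Fin.castLE hn k, j) = T k j := rfl
    simp only [normalForm, extendRows, hx, Fin.sum_univ_three, dif_pos hi]
    fin_cases k <;> fin_cases j <;> simp [c, genValues, Matrix.det_fin_three, ← hδ_def, h01, h02] <;>
      field_simp <;> (try rw [hδ_def]) <;> ring
  · have hrow : Matrix.vecMul (Matrix.vecMul (fun j => x (i, j)) T⁻¹) T = fun j => x (i, j) := by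
      rw [Matrix.vecMul_vecMul, Matrix.nonsing_inv_mul _ (isUnit_iff_ne_zero.mpr h3),
        Matrix.vecMul_one]
    have h : ∑ k, c i k * x (Fin.castLE hn k, j) = -x (i, j) := by
      rw [← congrFun hrow j]
      have : c i = -Matrix.vecMul (fun j => x (i, j)) T⁻¹ := by
        simp only [c]
        rw [if_neg (by omega), if_neg (by omega), if_neg (by omega)]
      simp only [this, Pi.neg_apply, neg_mul, Finset.sum_neg_distrib]
      rfl
    simp [normalForm, extendRows, hi, h]

lemma exists_genHom_eq {f : P n} (hQ : InQ n f) (hU : UInv n f) : ∃ F, f = genHom hn F := by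
  obtain ⟨N, F, hF⟩ := exists_clear_denominators f
  obtain ⟨hα, hβ, hγ⟩ := gens_ne_zero hn
  have h0 : genHom₄ hn F = beta3 n hn ^ N * (alpha1 n hn ^ N * f) := by
    refine mul_left_cancel₀ (mul_ne_zero (mul_ne_zero hα hβ) hγ) (MvPolynomial.funext fun x => ?_)
    by_cases hx : eval x (alpha1 n hn * beta3 n hn * gamma1 n hn) = 0
    · simp only [map_mul] at hx ⊢
      simp [hx]
    · simp only [map_mul, mul_ne_zero_iff, ← ne_eq] at hx
      obtain ⟨⟨h1, h2⟩, h3⟩ := hx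
      have hz := hF (fun k => genValues (topRows hn x) k.castSucc)
        (by rwa [← eval_gens]) (by rwa [← eval_gens])
      rw [← eval_eq_eval_normalForm hn hQ hU x h1 h2 h3, ← eval_genHom₄, ← eval_gens,
        ← eval_gens] at hz
      change _ = (eval x (alpha1 n hn) * eval x (beta3 n hn)) ^ N * _ at hz
      simp only [map_mul, map_pow, hz]
      ring
  have h1 : ∃ F', alpha1 n hn ^ N * f = genHom₄ hn F' := by
    generalize alpha1 n hn ^ N * f = h at h0
    clear hF
    induction N generalizing F with
    | zero => exact ⟨F, by simpa using h0.symm⟩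
    | succ N ih =>
      obtain ⟨F', hF'⟩ := exists_genHom₄_of_beta3_mul hn
        (h := beta3 n hn ^ N * h) (F := F) (by rw [h0]; ring)
      exact ih F' hF'.symm
  obtain ⟨G, hG⟩ : ∃ G, alpha1 n hn ^ N * f = genHom hn G := by
    obtain ⟨F', hF'⟩ := h1
    refine ⟨rename Fin.castSucc F', ?_⟩
    rw [hF', genHom, genHom₄, aeval_rename]
    congr 2
    funext k
    fin_cases k <;> rfl
  clear hF h0 h1
  induction N generalizing G with
  | zero => exact ⟨G, by simpa using hG⟩
  | succ N ih =>
    obtain ⟨G', hG'⟩ := exists_genHom_of_alpha1_mul hn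
      (h := alpha1 n hn ^ N * f) (F := G) (by rw [← hG]; ring)
    exact ih G' hG'

end Invariants

/-! ### The action of `S₃` -/

section Symmetric

variable {n : ℕ} (hn : 3 ≤ n)

lemma perm_fin_three_cases (σ : Equiv.Perm (Fin 3)) :
    (σ 0 = 0 ∧ σ 1 = 1 ∧ σ 2 = 2 ∧ Equiv.Perm.sign σ = 1) ∨
    (σ 0 = 1 ∧ σ 1 = 0 ∧ σ 2 = 2 ∧ Equiv.Perm.sign σ = -1) ∨
    (σ 0 = 2 ∧ σ 1 = 1 ∧ σ 2 = 0 ∧ Equiv.Perm.sign σ = -1) ∨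
    (σ 0 = 0 ∧ σ 1 = 2 ∧ σ 2 = 1 ∧ Equiv.Perm.sign σ = -1) ∨
    (σ 0 = 1 ∧ σ 1 = 2 ∧ σ 2 = 0 ∧ Equiv.Perm.sign σ = 1) ∨
    (σ 0 = 2 ∧ σ 1 = 0 ∧ σ 2 = 1 ∧ Equiv.Perm.sign σ = 1) := by
  revert σ
  decide

lemma sum_perm_fin_three {M : Type*} [AddCommMonoid M] (H : Fin 3 → Fin 3 → ℤˣ → M) :
    ∑ σ : Equiv.Perm (Fin 3), H (σ 0) (σ 1) (Equiv.Perm.sign σ) =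
      H 0 1 1 + (H 1 0 (-1) + (H 2 1 (-1) + (H 0 2 (-1) + (H 1 2 1 + H 2 0 1)))) := by
  have huniv : (Finset.univ : Finset (Equiv.Perm (Fin 3))) =
      {1, Equiv.swap 0 1, Equiv.swap 0 2, Equiv.swap 1 2, Equiv.swap 0 1 * Equiv.swap 1 2,
        Equiv.swap 1 2 * Equiv.swap 0 1} := by decide
  rw [huniv, Finset.sum_insert (by decide), Finset.sum_insert (by decide),
    Finset.sum_insert (by decide), Finset.sum_insert (by decide), Finset.sum_insert (by decide),
    Finset.sum_singleton]
  rfl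

lemma permAct_Xe (σ : Equiv.Perm (Fin 3)) (i j : Fin 3) :
    permAct n σ (Xe n hn i j) = Xe n hn i (σ j) := by
  simp [permAct, Xe]

/-- Three vectors in the span of `β₂, β₃` that are permuted by `S₃`. -/
def orbit : Fin 3 → P n :=
  ![beta2 n hn + beta3 n hn, beta2 n hn - 2 * beta3 n hn, beta3 n hn - 2 * beta2 n hn]

lemma permAct_orbit (σ : Equiv.Perm (Fin 3)) (i : Fin 3) :
    permAct n σ (orbit hn i) = orbit hn (σ i) := by
  rcases perm_fin_three_cases σ with ⟨h0, h1, h2, -⟩ | ⟨h0, h1, h2, -⟩ | ⟨h0, h1, h2, -⟩ |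
    ⟨h0, h1, h2, -⟩ | ⟨h0, h1, h2, -⟩ | ⟨h0, h1, h2, -⟩ <;> fin_cases i <;>
  simp only [Fin.zero_eta, Fin.mk_one, Fin.reduceFinMk, h0, h1, h2, orbit, Matrix.cons_val,
      beta2, beta3, del, map_add, map_sub, map_mul, map_ofNat, permAct_Xe] <;> ring

lemma alpha2_eq_orbit : 6 * alpha2 n hn = orbit hn 0 ^ 2 + orbit hn 1 ^ 2 + orbit hn 2 ^ 2 := by
  simp only [alpha2, orbit, Matrix.cons_val]
  ring

lemma alpha3_eq_orbit : alpha3 n hn = -(orbit hn 0 * orbit hn 1 * orbit hn 2) := by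
  simp only [alpha3, orbit, Matrix.cons_val]
  ring

lemma permAct_alpha1 (σ : Equiv.Perm (Fin 3)) : permAct n σ (alpha1 n hn) = alpha1 n hn := by
  rcases perm_fin_three_cases σ with ⟨h0, h1, h2, -⟩ | ⟨h0, h1, h2, -⟩ | ⟨h0, h1, h2, -⟩ |
    ⟨h0, h1, h2, -⟩ | ⟨h0, h1, h2, -⟩ | ⟨h0, h1, h2, -⟩ <;>
  simp only [alpha1, map_mul, permAct_Xe, h0, h1, h2] <;> ring

lemma permAct_alpha2 (σ : Equiv.Perm (Fin 3)) : permAct n σ (alpha2 n hn) = alpha2 n hn := by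
  have h6 : (6 : P n) ≠ 0 := by norm_num
  refine mul_left_cancel₀ h6 ?_
  rw [show (6 : P n) * permAct n σ (alpha2 n hn) = permAct n σ (6 * alpha2 n hn) by
    rw [map_mul, map_ofNat], alpha2_eq_orbit]
  simp only [map_add, map_pow, permAct_orbit]
  rcases perm_fin_three_cases σ with ⟨h0, h1, h2, -⟩ | ⟨h0, h1, h2, -⟩ | ⟨h0, h1, h2, -⟩ |
    ⟨h0, h1, h2, -⟩ | ⟨h0, h1, h2, -⟩ | ⟨h0, h1, h2, -⟩ <;> rw [h0, h1, h2] <;> ring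

lemma permAct_alpha3 (σ : Equiv.Perm (Fin 3)) : permAct n σ (alpha3 n hn) = alpha3 n hn := by
  simp only [alpha3_eq_orbit, map_neg, map_mul, permAct_orbit]
  rcases perm_fin_three_cases σ with ⟨h0, h1, h2, -⟩ | ⟨h0, h1, h2, -⟩ | ⟨h0, h1, h2, -⟩ |
    ⟨h0, h1, h2, -⟩ | ⟨h0, h1, h2, -⟩ | ⟨h0, h1, h2, -⟩ <;> rw [h0, h1, h2] <;> ring

lemma permAct_gamma1 (σ : Equiv.Perm (Fin 3)) :
    permAct n σ (gamma1 n hn) = ((Equiv.Perm.sign σ : ℤ) : ℂ) • gamma1 n hn := by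
  rcases perm_fin_three_cases σ with ⟨h0, h1, h2, hs⟩ | ⟨h0, h1, h2, hs⟩ | ⟨h0, h1, h2, hs⟩ |
    ⟨h0, h1, h2, hs⟩ | ⟨h0, h1, h2, hs⟩ | ⟨h0, h1, h2, hs⟩ <;>
  simp only [gamma1, Matrix.det_fin_three, Matrix.of_apply, map_add, map_sub, map_mul,
      permAct_Xe, h0, h1, h2, hs, Units.val_one, Units.val_neg, Int.cast_neg, Int.cast_one,
      one_smul, neg_smul] <;> ring

lemma permAct_gamma2 (σ : Equiv.Perm (Fin 3)) :
    permAct n σ (gamma2 n hn) = ((Equiv.Perm.sign σ : ℤ) : ℂ) • gamma2 n hn := by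
  rcases perm_fin_three_cases σ with ⟨h0, h1, h2, hs⟩ | ⟨h0, h1, h2, hs⟩ | ⟨h0, h1, h2, hs⟩ |
    ⟨h0, h1, h2, hs⟩ | ⟨h0, h1, h2, hs⟩ | ⟨h0, h1, h2, hs⟩ <;>
  simp only [gamma2, del, map_sub, map_mul, permAct_Xe, h0, h1, h2, hs, Units.val_one,
      Units.val_neg, Int.cast_neg, Int.cast_one, one_smul, neg_smul] <;> ring

/-- The monomial `α₁^a α₂^b α₃^c γ₁^d γ₂^e`. -/
def semiMon (a b c d e : ℕ) : P n :=
  alpha1 n hn ^ a * alpha2 n hn ^ b * alpha3 n hn ^ c * gamma1 n hn ^ d * gamma2 n hn ^ e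

lemma permAct_semiMon (σ : Equiv.Perm (Fin 3)) (a b c d e : ℕ) :
    permAct n σ (semiMon hn a b c d e) =
      ((Equiv.Perm.sign σ : ℤ) : ℂ) ^ (d + e) • semiMon hn a b c d e := by
  simp only [semiMon, map_mul, map_pow, permAct_alpha1, permAct_alpha2, permAct_alpha3,
    permAct_gamma1, permAct_gamma2, smul_pow, mul_smul_comm, smul_mul_assoc, smul_smul, pow_add]
  rw [mul_comm]

lemma semiMon_mem_span (a b c : ℕ) {d e : ℕ} (h : Odd (d + e)) :
    semiMon hn a b c d e ∈ Submodule.span ℂ (Set.range (Ssgn n hn)) := by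
  refine Submodule.subset_span ?_
  rcases Nat.even_or_odd' d with ⟨k, rfl | rfl⟩ <;> rcases Nat.even_or_odd' e with ⟨l, rfl | rfl⟩
  · exact absurd h (by simp [parity_simps])
  · exact ⟨Sum.inr (a, b, c, k, l), rfl⟩
  · exact ⟨Sum.inl (a, b, c, k, l), rfl⟩
  · exact absurd h (by simp [parity_simps])

/-- The antisymmetrizer `∑ σ, sgn σ · σ`. -/
def antisymmetrize (n : ℕ) : P n →ₗ[ℂ] P n :=
  ∑ σ : Equiv.Perm (Fin 3), ((Equiv.Perm.sign σ : ℤ) : ℂ) • (permAct n σ).toLinearMap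

/-- The products of a monomial in `α₁, α₂, α₃, γ₁, γ₂` and one of the six monomials forming a
basis of `ℂ[β₂, β₃]` over `ℂ[α₂, α₃]`. -/
def moduleGen : (ℕ × ℕ × ℕ × ℕ × ℕ) × Fin 3 × Fin 2 → P n
  | ((a, b, c, d, e), i, j) =>
    semiMon hn a b c d e * (orbit hn 0 ^ (i : ℕ) * orbit hn 1 ^ (j : ℕ))

lemma antisymmetrize_moduleGen (a b c d e : ℕ) (i : Fin 3) (j : Fin 2) :
    antisymmetrize n (moduleGen hn ((a, b, c, d, e), i, j)) = semiMon hn a b c d e *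
      ∑ σ : Equiv.Perm (Fin 3), ((Equiv.Perm.sign σ : ℤ) : ℂ) ^ (d + e + 1) •
        (orbit hn (σ 0) ^ (i : ℕ) * orbit hn (σ 1) ^ (j : ℕ)) := by
  simp only [antisymmetrize, moduleGen, LinearMap.sum_apply, LinearMap.smul_apply, AlgHom.toLinearMap_apply,
    map_mul, map_pow, permAct_semiMon, permAct_orbit, Finset.mul_sum]
  refine Finset.sum_congr rfl fun σ _ => ?_
  rw [smul_mul_assoc, smul_smul, mul_smul_comm, pow_succ']

lemma antisymmetrize_moduleGen_mem (q : (ℕ × ℕ × ℕ × ℕ × ℕ) × Fin 3 × Fin 2) :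
    antisymmetrize n (moduleGen hn q) ∈ Submodule.span ℂ (Set.range (Ssgn n hn)) := by
  obtain ⟨⟨a, b, c, d, e⟩, i, j⟩ := q
  rw [antisymmetrize_moduleGen, sum_perm_fin_three fun k l s =>
    ((s : ℤ) : ℂ) ^ (d + e + 1) • (orbit hn k ^ (i : ℕ) * orbit hn l ^ (j : ℕ))]
  simp only [Units.val_one, Units.val_neg, Int.cast_neg, Int.cast_one, one_pow, one_smul]
  rcases Nat.even_or_odd (d + e) with h | h
  · rw [h.add_one.neg_one_pow]
    have hmem := semiMon_mem_span hn (a + 1) b c (d := d) (e := e + 1)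
      (by rw [← add_assoc]; exact h.add_one)
    have hrel : semiMon hn (a + 1) b c d (e + 1) = semiMon hn a b c d e *
        (beta2 n hn * beta3 n hn * (beta2 n hn - beta3 n hn)) := by
      rw [beta_relation]
      simp only [semiMon]
      ring
    convert Submodule.smul_mem _ (!![0, 0; 0, 0; 0, 27] i j : ℂ) hmem using 1
    rw [hrel]
    fin_cases i <;> fin_cases j <;>
    simp [orbit, Algebra.smul_def, map_ofNat, -algebraMap_eq, -mul_eq_zero,
      -mul_eq_mul_left_iff] <;> ring
  · rw [h.add_one.neg_one_pow]
    have h1 := semiMon_mem_span hn a b c h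
    have h2 := semiMon_mem_span hn a (b + 1) c h
    have h3 := semiMon_mem_span hn a b (c + 1) h
    have e2 : semiMon hn a (b + 1) c d e = semiMon hn a b c d e * alpha2 n hn := by
      simp only [semiMon]
      ring
    have e3 : semiMon hn a b (c + 1) d e = semiMon hn a b c d e * alpha3 n hn := by
      simp only [semiMon]
      ring
    convert add_mem (add_mem (Submodule.smul_mem _ (!![6, 0; 0, 0; 0, 0] i j : ℂ) h1)
      (Submodule.smul_mem _ (!![0, 0; 0, -6; 12, 0] i j : ℂ) h2))
      (Submodule.smul_mem _ (!![0, 0; 0, 0; 0, 3] i j : ℂ) h3) using 1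
    rw [e2, e3]
    fin_cases i <;> fin_cases j <;>
    simp [orbit, alpha2, alpha3, Algebra.smul_def, map_ofNat, -algebraMap_eq, -mul_eq_zero,
      -mul_eq_mul_left_iff] <;> ring

lemma mul_mem_span_moduleGen {g : P n}
    (hg : ∀ q, g * moduleGen hn q ∈ Submodule.span ℂ (Set.range (moduleGen hn))) {f : P n}
    (hf : f ∈ Submodule.span ℂ (Set.range (moduleGen hn))) :
    g * f ∈ Submodule.span ℂ (Set.range (moduleGen hn)) := by
  induction hf using Submodule.span_induction with
  | mem f hf =>
    obtain ⟨q, rfl⟩ := hf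
    exact hg q
  | zero => rw [mul_zero]; exact zero_mem _
  | add f₁ f₂ _ _ h₁ h₂ => rw [mul_add]; exact add_mem h₁ h₂
  | smul r f _ h => rw [mul_smul_comm]; exact Submodule.smul_mem _ r h

lemma semiMon_mul_mem_span_moduleGen (a b c d e : ℕ) {f : P n}
    (hf : f ∈ Submodule.span ℂ (Set.range (moduleGen hn))) :
    semiMon hn a b c d e * f ∈ Submodule.span ℂ (Set.range (moduleGen hn)) := by
  refine mul_mem_span_moduleGen hn ?_ hf
  rintro ⟨⟨a', b', c', d', e'⟩, i, j⟩
  refine Submodule.subset_span ⟨((a + a', b + b', c + c', d + d', e + e'), i, j), ?_⟩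
  simp only [moduleGen, semiMon, pow_add]
  ring

lemma moduleGen_mem (q : (ℕ × ℕ × ℕ × ℕ × ℕ) × Fin 3 × Fin 2) :
    moduleGen hn q ∈ Submodule.span ℂ (Set.range (moduleGen hn)) :=
  Submodule.subset_span ⟨q, rfl⟩

lemma orbit_zero_mul_mem {f : P n} (hf : f ∈ Submodule.span ℂ (Set.range (moduleGen hn))) :
    orbit hn 0 * f ∈ Submodule.span ℂ (Set.range (moduleGen hn)) := by
  refine mul_mem_span_moduleGen hn ?_ hf
  rintro ⟨⟨a, b, c, d, e⟩, i, j⟩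
  have hmem (i : Fin 3) := moduleGen_mem hn ((a, b, c, d, e), i, j)
  have hcubic : orbit hn 0 ^ 3 = 3 * alpha2 n hn * orbit hn 0 - alpha3 n hn := by
    simp only [orbit, alpha2, alpha3, Matrix.cons_val]
    ring
  fin_cases i
  · convert hmem 1 using 1
    simp [moduleGen]
    ring
  · convert hmem 2 using 1
    simp [moduleGen]
    ring
  · convert sub_mem
      (Submodule.smul_mem _ (3 : ℂ) (semiMon_mul_mem_span_moduleGen hn 0 1 0 0 0 (hmem 1)))
      (semiMon_mul_mem_span_moduleGen hn 0 0 1 0 0 (hmem 0)) using 1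
    simp only [moduleGen, Algebra.smul_def, map_ofNat]
    simp [semiMon]
    linear_combination (alpha1 n hn ^ a * alpha2 n hn ^ b * alpha3 n hn ^ c * gamma1 n hn ^ d *
      gamma2 n hn ^ e * orbit hn 1 ^ (j : ℕ)) * hcubic

lemma orbit_one_mul_mem {f : P n} (hf : f ∈ Submodule.span ℂ (Set.range (moduleGen hn))) :
    orbit hn 1 * f ∈ Submodule.span ℂ (Set.range (moduleGen hn)) := by
  refine mul_mem_span_moduleGen hn ?_ hf
  rintro ⟨⟨a, b, c, d, e⟩, i, j⟩
  have hmem (j : Fin 2) := moduleGen_mem hn ((a, b, c, d, e), i, j)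
  have hquad : orbit hn 1 ^ 2 =
      3 * alpha2 n hn - orbit hn 0 * orbit hn 1 - orbit hn 0 * orbit hn 0 := by
    simp only [orbit, alpha2, Matrix.cons_val]
    ring
  fin_cases j
  · convert hmem 1 using 1
    simp [moduleGen]
    ring
  · convert sub_mem (sub_mem
      (Submodule.smul_mem _ (3 : ℂ) (semiMon_mul_mem_span_moduleGen hn 0 1 0 0 0 (hmem 0)))
      (orbit_zero_mul_mem hn (hmem 1)))
      (orbit_zero_mul_mem hn (orbit_zero_mul_mem hn (hmem 0))) using 1
    simp only [moduleGen, Algebra.smul_def, map_ofNat]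
    simp [semiMon]
    linear_combination (alpha1 n hn ^ a * alpha2 n hn ^ b * alpha3 n hn ^ c * gamma1 n hn ^ d *
      gamma2 n hn ^ e * orbit hn 0 ^ (i : ℕ)) * hquad

lemma genHom_mem_span_moduleGen (F : MvPolynomial (Fin 5) ℂ) :
    genHom hn F ∈ Submodule.span ℂ (Set.range (moduleGen hn)) := by
  induction F using MvPolynomial.induction_on with
  | C r =>
    convert Submodule.smul_mem _ r (moduleGen_mem hn ((0, 0, 0, 0, 0), 0, 0)) using 1
    simp [moduleGen, semiMon, genHom, Algebra.smul_def]
  | add F G hF hG =>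
    rw [map_add]
    exact add_mem hF hG
  | mul_X F k hF =>
    rw [map_mul, mul_comm, show genHom hn (X k) =
      ![alpha1 n hn, beta2 n hn, beta3 n hn, gamma1 n hn, gamma2 n hn] k from aeval_X _ _]
    generalize genHom hn F = f at hF
    have hβ : beta3 n hn * f ∈ Submodule.span ℂ (Set.range (moduleGen hn)) := by
      convert Submodule.smul_mem _ (3⁻¹ : ℂ)
        (sub_mem (orbit_zero_mul_mem hn hF) (orbit_one_mul_mem hn hF)) using 1
      rw [eq_inv_smul_iff₀ three_ne_zero, Algebra.smul_def, map_ofNat]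
      simp only [orbit, Matrix.cons_val]
      ring
    fin_cases k
    · simpa [semiMon] using semiMon_mul_mem_span_moduleGen hn 1 0 0 0 0 hF
    · convert sub_mem (orbit_zero_mul_mem hn hF) hβ using 1
      simp [orbit]
      ring
    · exact hβ
    · simpa [semiMon] using semiMon_mul_mem_span_moduleGen hn 0 0 0 1 0 hF
    · simpa [semiMon] using semiMon_mul_mem_span_moduleGen hn 0 0 0 0 1 hF

lemma antisymmetrize_genHom_mem (F : MvPolynomial (Fin 5) ℂ) :
    antisymmetrize n (genHom hn F) ∈ Submodule.span ℂ (Set.range (Ssgn n hn)) := by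
  have hF := genHom_mem_span_moduleGen hn F
  generalize genHom hn F = f at hF ⊢
  induction hF using Submodule.span_induction with
  | mem f hf =>
    obtain ⟨q, rfl⟩ := hf
    exact antisymmetrize_moduleGen_mem hn q
  | zero => rw [map_zero]; exact zero_mem _
  | add f₁ f₂ _ _ h₁ h₂ => rw [map_add]; exact add_mem h₁ h₂
  | smul r f _ h => rw [map_smul]; exact Submodule.smul_mem _ r h

lemma antisymmetrize_eq_six_smul {f : P n}
    (hf : ∀ σ : Equiv.Perm (Fin 3), permAct n σ f = ((Equiv.Perm.sign σ : ℤ) : ℂ) • f) :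
    antisymmetrize n f = (6 : ℂ) • f := by
  have hs (σ : Equiv.Perm (Fin 3)) :
      ((Equiv.Perm.sign σ : ℤ) : ℂ) * ((Equiv.Perm.sign σ : ℤ) : ℂ) = 1 := by
    rw [← Int.cast_mul, ← Units.val_mul, Int.units_mul_self]
    simp
  simp only [antisymmetrize, LinearMap.sum_apply, LinearMap.smul_apply, AlgHom.toLinearMap_apply,
    hf, smul_smul, hs, one_smul, Finset.sum_const, Finset.card_univ, Fintype.card_perm,
    Fintype.card_fin]
  rw [← Nat.cast_smul_eq_nsmul ℂ]
  norm_num [Nat.factorial]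

end Symmetric

/-! ### The spanning elements are antisymmetric invariants -/

section Spanning

variable {n : ℕ} (hn : 3 ≤ n)

/-- `Q` as a subalgebra of `𝒫`. -/
def balancedSubalgebra (n : ℕ) : Subalgebra ℂ (P n) where
  carrier := {f | InQ n f}
  mul_mem' {f g} hf hg d hd j := by
    obtain ⟨a, ha, b, hb, rfl⟩ := Finset.mem_add.mp (support_mul f g hd)
    simp only [Finsupp.add_apply, Finset.sum_add_distrib]
    rw [hf a ha j, hg b hb j]
  add_mem' {f g} hf hg d hd j :=
    (Finset.mem_union.mp (support_add hd)).elim (fun h => hf d h j) (fun h => hg d h j)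
  algebraMap_mem' r d hd j := by
    rw [algebraMap_eq, mem_support_iff, coeff_C] at hd
    obtain rfl : 0 = d := by
      by_contra h
      exact hd (if_neg h)
    simp

lemma Xe_mul_Xe_mul_Xe_mem (i j k : Fin 3) :
    Xe n hn i 0 * Xe n hn j 1 * Xe n hn k 2 ∈ balancedSubalgebra n := by
  intro d hd l
  rw [Xe, Xe, Xe, X, X, X, monomial_mul, monomial_mul] at hd
  obtain rfl := Finset.mem_singleton.mp (support_monomial_subset hd)
  simp only [Finsupp.add_apply, Finset.sum_add_distrib, Finsupp.single_apply, Prod.mk.injEq]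
  fin_cases l <;> simp

lemma gens_mem_balancedSubalgebra : alpha1 n hn ∈ balancedSubalgebra n ∧
    beta2 n hn ∈ balancedSubalgebra n ∧ beta3 n hn ∈ balancedSubalgebra n ∧
    gamma1 n hn ∈ balancedSubalgebra n ∧ gamma2 n hn ∈ balancedSubalgebra n := by
  have t := Xe_mul_Xe_mul_Xe_mem hn
  refine ⟨t 0 0 0, ?_, ?_, ?_, ?_⟩
  · convert sub_mem (t 0 0 1) (t 1 0 0) using 1
    simp only [beta2, del]
    ring
  · convert sub_mem (t 0 1 0) (t 1 0 0) using 1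
    simp only [beta3, del]
    ring
  · convert sub_mem (add_mem (add_mem (t 0 1 2) (t 1 2 0)) (t 2 0 1))
      (add_mem (add_mem (t 0 2 1) (t 1 0 2)) (t 2 1 0)) using 1
    simp only [gamma1, Matrix.det_fin_three, Matrix.of_apply]
    ring
  · convert sub_mem
      (add_mem (add_mem (mul_mem (t 0 0 1) (t 0 1 1)) (mul_mem (t 0 1 0) (t 1 1 0)))
        (mul_mem (t 1 0 0) (t 1 0 1)))
      (add_mem (add_mem (mul_mem (t 0 1 0) (t 0 1 1)) (mul_mem (t 0 0 1) (t 1 0 1)))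
        (mul_mem (t 1 0 0) (t 1 1 0))) using 1
    simp only [gamma2, del]
    ring

lemma alphas_mem_balancedSubalgebra :
    alpha2 n hn ∈ balancedSubalgebra n ∧ alpha3 n hn ∈ balancedSubalgebra n := by
  obtain ⟨-, h2, h3, -, -⟩ := gens_mem_balancedSubalgebra hn
  exact ⟨sub_mem (add_mem (pow_mem h2 2) (pow_mem h3 2)) (mul_mem h2 h3),
    sub_mem (mul_mem (ofNat_mem _ 2) (add_mem (pow_mem h2 3) (pow_mem h3 3)))
      (mul_mem (ofNat_mem _ 3) (add_mem (mul_mem (pow_mem h2 2) h3) (mul_mem h2 (pow_mem h3 2))))⟩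

lemma matAct_Xe {g : Matrix (Fin n) (Fin n) ℂ} (hg : IsUpperUni n g) (i j : Fin 3) :
    matAct n g (Xe n hn i j) =
      ∑ k : Fin 3, C (g (Fin.castLE hn k) (Fin.castLE hn i)) * Xe n hn k j := by
  rw [matAct, Xe, aeval_X]
  refine (Fintype.sum_of_injective (Fin.castLE hn) (Fin.castLE_injective hn) _ _ (fun s hs => ?_)
    fun k => rfl).symm
  have his : Fin.castLE hn i < s := by
    by_contra! h
    exact hs ⟨⟨s, (Fin.le_def.mp h).trans_lt i.isLt⟩, rfl⟩
  rw [hg.2 _ _ his, map_zero, zero_mul]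

lemma matAct_gens {g : Matrix (Fin n) (Fin n) ℂ} (hg : IsUpperUni n g) :
    matAct n g (alpha1 n hn) = alpha1 n hn ∧ matAct n g (beta2 n hn) = beta2 n hn ∧
    matAct n g (beta3 n hn) = beta3 n hn ∧ matAct n g (gamma1 n hn) = gamma1 n hn ∧
    matAct n g (gamma2 n hn) = gamma2 n hn := by
  have hlt {i j : Fin 3} (hij : j < i) : g (Fin.castLE hn i) (Fin.castLE hn j) = 0 :=
    hg.2 _ _ hij
  have h10 := hlt (i := 1) (j := 0) (by decide)
  have h20 := hlt (i := 2) (j := 0) (by decide)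
  have h21 := hlt (i := 2) (j := 1) (by decide)
  refine ⟨?_, ?_, ?_, ?_, ?_⟩ <;>
    simp only [alpha1, beta2, beta3, gamma1, gamma2, del, Matrix.det_fin_three, Matrix.of_apply,
      map_add, map_sub, map_mul, matAct_Xe hn hg, Fin.sum_univ_three, hg.1, h10, h20, h21,
      map_zero, map_one, zero_mul, one_mul, add_zero] <;> ring

lemma Ssgn_eq_semiMon (q : (ℕ × ℕ × ℕ × ℕ × ℕ) ⊕ (ℕ × ℕ × ℕ × ℕ × ℕ)) :
    ∃ a b c d e, Odd (d + e) ∧ Ssgn n hn q = semiMon hn a b c d e := by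
  rcases q with ⟨a, b, c, d, e⟩ | ⟨a, b, c, d, e⟩
  · exact ⟨a, b, c, 2 * d + 1, 2 * e, by simp [parity_simps], rfl⟩
  · exact ⟨a, b, c, 2 * d, 2 * e + 1, by simp [parity_simps], rfl⟩

lemma inQ_semiMon (a b c d e : ℕ) : InQ n (semiMon hn a b c d e) := by
  obtain ⟨h1, -, -, h4, h5⟩ := gens_mem_balancedSubalgebra hn
  obtain ⟨h2, h3⟩ := alphas_mem_balancedSubalgebra hn
  exact mul_mem (mul_mem (mul_mem (mul_mem (pow_mem h1 a) (pow_mem h2 b)) (pow_mem h3 c))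
    (pow_mem h4 d)) (pow_mem h5 e)

lemma uInv_semiMon (a b c d e : ℕ) : UInv n (semiMon hn a b c d e) := by
  intro g hg
  obtain ⟨h1, h2, h3, h4, h5⟩ := matAct_gens hn hg
  simp only [semiMon, alpha2, alpha3, map_add, map_sub, map_mul, map_pow, map_ofNat, h1, h2, h3,
    h4, h5]

lemma permAct_semiMon_of_odd (σ : Equiv.Perm (Fin 3)) (a b c : ℕ) {d e : ℕ} (h : Odd (d + e)) :
    permAct n σ (semiMon hn a b c d e) =
      ((Equiv.Perm.sign σ : ℤ) : ℂ) • semiMon hn a b c d e := by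
  rw [permAct_semiMon]
  rcases Int.units_eq_one_or (Equiv.Perm.sign σ) with hs | hs <;> simp [hs, h.neg_one_pow]

end Spanning

/-- `(Q^{U_n})^{sgn}` is spanned as a ℂ-vector space by the elements
`α₁^a α₂^b α₃^c γ₁^{2d+1} γ₂^{2e}` and `α₁^a α₂^b α₃^c γ₁^{2d} γ₂^{2e+1}`. -/
theorem stmt_17 (n : ℕ) (hn : 3 ≤ n) :
    (Submodule.span ℂ (Set.range (Ssgn n hn)) : Set (P n)) =
      {f : P n | InQ n f ∧ UInv n f ∧
        ∀ σ : Equiv.Perm (Fin 3), permAct n σ f = ((Equiv.Perm.sign σ : ℤ) : ℂ) • f} := by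
  ext f
  constructor
  · intro hf
    change f ∈ Submodule.span ℂ (Set.range (Ssgn n hn)) at hf
    induction hf using Submodule.span_induction with
    | mem f hf =>
      obtain ⟨q, rfl⟩ := hf
      obtain ⟨a, b, c, d, e, hodd, hq⟩ := Ssgn_eq_semiMon hn q
      rw [hq]
      exact ⟨inQ_semiMon hn a b c d e, uInv_semiMon hn a b c d e,
        fun σ => permAct_semiMon_of_odd hn σ a b c hodd⟩
    | zero => exact ⟨zero_mem (balancedSubalgebra n), fun g _ => map_zero _, fun σ => by simp⟩
    | add f₁ f₂ _ _ h₁ h₂ =>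
      obtain ⟨hQ₁, hU₁, hs₁⟩ := h₁
      obtain ⟨hQ₂, hU₂, hs₂⟩ := h₂
      exact ⟨add_mem (S := Subalgebra ℂ (P n)) (s := balancedSubalgebra n) hQ₁ hQ₂,
        fun g hg => by rw [map_add, hU₁ g hg, hU₂ g hg],
        fun σ => by rw [map_add, hs₁, hs₂, smul_add]⟩
    | smul r f _ h =>
      obtain ⟨hQ, hU, hs⟩ := h
      exact ⟨(balancedSubalgebra n).smul_mem hQ r, fun g hg => by rw [map_smul, hU g hg],
        fun σ => by rw [map_smul, hs, smul_comm]⟩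
  · rintro ⟨hQ, hU, hs⟩
    obtain ⟨F, hF⟩ := exists_genHom_eq hn hQ hU
    have h6 : f = (6⁻¹ : ℂ) • antisymmetrize n f := by
      rw [antisymmetrize_eq_six_smul hs, inv_smul_smul₀ (by norm_num)]
    rw [h6, hF]
    exact Submodule.smul_mem _ _ (antisymmetrize_genHom_mem hn F)
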